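/- arXiv:2112.04599 — 11 statements merged into one kernel-verified Lean document; each statement's English description precedes it below -/
import Mathlib

section
/- Let E be a stable system of morphisms in a category C with chosen pullbacks. Then the equivalence relation ∼_E on spans is compatible with horizontal composition: if (f,g) ∼_E (f',g') : A ⇸ B and (h,k) ∼_E (h',k') : B ⇸ C, then (h,k)∘(f,g) ∼_E (h',k')∘(f',g') as spans A ⇸ C. -/
open CategoryTheory CategoryTheory.Limits

universe v u

/-- A span `(f,g) : A ⇸ B` in `C`: an apex `D` with `f : D ⟶ A` and `g : D ⟶ B`. -/
structure MySpan (C : Type u) [Category.{v} C] (A B : C) where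
  apex : C
  left : apex ⟶ A
  right : apex ⟶ B

namespace MySpan

variable {C : Type u} [Category.{v} C]

/-- The involution `(f,g)° = (g,f)`. -/
def symm {A B : C} (S : MySpan C A B) : MySpan C B A :=
  ⟨S.apex, S.right, S.left⟩

/-- The horizontal composite `(h,k)∘(f,g)` of `S = (f,g) : A ⇸ B` with `T = (h,k) : B ⇸ X`,
computed via the chosen pullback of `g` and `h`. -/
noncomputable def comp [HasPullbacks C] {A B X : C} (S : MySpan C A B) (T : MySpan C B X) :
    MySpan C A X :=
  ⟨pullback S.right T.left, pullback.fst S.right T.left ≫ S.left,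
    pullback.snd S.right T.left ≫ T.right⟩

/-- The meet `(f,g)∧(p,q)` of two parallel spans, computed via the chosen pullback of
`⟨f,g⟩` and `⟨p,q⟩`. -/
noncomputable def meet [HasPullbacks C] [HasBinaryProducts C] {A B : C}
    (S T : MySpan C A B) : MySpan C A B :=
  ⟨pullback (prod.lift S.left S.right) (prod.lift T.left T.right),
    pullback.fst (prod.lift S.left S.right) (prod.lift T.left T.right) ≫ S.left,
    pullback.fst (prod.lift S.left S.right) (prod.lift T.left T.right) ≫ S.right⟩

end MySpan

variable {C : Type u} [Category.{v} C]

/-- `S ≤_E T` : there is a morphism of spans `x : S → T` lying in `E`. -/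
def SpanLe (E : MorphismProperty C) {A B : C} (S T : MySpan C A B) : Prop :=
  ∃ x : S.apex ⟶ T.apex, E x ∧ x ≫ T.left = S.left ∧ x ≫ T.right = S.right

/-- `∼_E` : the least equivalence relation on spans `A ⇸ B` containing `≤_E`. -/
def SpanSim (E : MorphismProperty C) {A B : C} : MySpan C A B → MySpan C A B → Prop :=
  Relation.EqvGen (SpanLe E)

/-- A stable system: a class of morphisms containing all isomorphisms, closed under
composition, and stable under pullback. -/
structure IsStableSystem (E : MorphismProperty C) : Prop where
  of_isIso : ∀ {X Y : C} (f : X ⟶ Y), IsIso f → E f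
  comp_mem : ∀ {X Y Z : C} (f : X ⟶ Y) (g : Y ⟶ Z), E f → E g → E (f ≫ g)
  pullback_stable : ∀ {P X Y Z : C} (fst : P ⟶ X) (snd : P ⟶ Y) (f : X ⟶ Z) (g : Y ⟶ Z),
    IsPullback fst snd f g → E g → E fst

/-- `∼_E` is allegorical: `(1_A, f) ∼_E (p₁, f∘p₂)` with `(p₁,p₂)` the kernel pair of `f`,
i.e. `(1_A,f) ∼_E (f,f)∘(1_A,f)`. -/
def SimAllegorical [HasPullbacks C] (E : MorphismProperty C) : Prop :=
  ∀ {A B : C} (f : A ⟶ B),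
    SpanSim E (⟨A, 𝟙 A, f⟩ : MySpan C A B)
      ⟨pullback f f, pullback.fst f f, pullback.snd f f ≫ f⟩

/-- Composition of spans is monotone for `≤_E` in its first argument. -/
theorem SpanLe.comp_right [HasPullbacks C] {E : MorphismProperty C} (hE : IsStableSystem E)
    {A B X : C} {S S' : MySpan C A B} (h : SpanLe E S S') (T : MySpan C B X) :
    SpanLe E (S.comp T) (S'.comp T) := by
  obtain ⟨x, hx, hl, hr⟩ := h
  have w : (pullback.fst S.right T.left ≫ x) ≫ S'.right = pullback.snd S.right T.left ≫ T.left := by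
    rw [Category.assoc, hr, pullback.condition]
  have hP : IsPullback (pullback.lift _ _ w) (pullback.fst S.right T.left)
      (pullback.fst S'.right T.left) x := by
    refine IsPullback.of_right ?_ (pullback.lift_fst _ _ _)
      (IsPullback.of_hasPullback S'.right T.left).flip
    rw [pullback.lift_snd, hr]
    exact (IsPullback.of_hasPullback S.right T.left).flip
  refine ⟨pullback.lift _ _ w, hE.pullback_stable _ _ _ _ hP hx, ?_, ?_⟩
  · simp only [MySpan.comp, pullback.lift_fst_assoc, Category.assoc, hl]
  · simp only [MySpan.comp, pullback.lift_snd_assoc]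

/-- Composition of spans is monotone for `≤_E` in its second argument. -/
theorem SpanLe.comp_left [HasPullbacks C] {E : MorphismProperty C} (hE : IsStableSystem E)
    {A B X : C} (S : MySpan C A B) {T T' : MySpan C B X} (h : SpanLe E T T') :
    SpanLe E (S.comp T) (S.comp T') := by
  obtain ⟨x, hx, hl, hr⟩ := h
  have w : pullback.fst S.right T.left ≫ S.right = (pullback.snd S.right T.left ≫ x) ≫ T'.left := by
    rw [Category.assoc, hl, pullback.condition]
  have hP : IsPullback (pullback.lift _ _ w) (pullback.snd S.right T.left)
      (pullback.snd S.right T'.left) x := by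
    refine IsPullback.of_right ?_ (pullback.lift_snd _ _ _)
      (IsPullback.of_hasPullback S.right T'.left)
    rw [pullback.lift_fst, hl]
    exact IsPullback.of_hasPullback S.right T.left
  refine ⟨pullback.lift _ _ w, hE.pullback_stable _ _ _ _ hP hx, ?_, ?_⟩
  · simp only [MySpan.comp, pullback.lift_fst_assoc]
  · simp only [MySpan.comp, pullback.lift_snd_assoc, Category.assoc, hr]

/-- A map of spans that is monotone for `≤_E` preserves `∼_E`. -/
theorem SpanSim.map {E : MorphismProperty C} {A B A' B' : C}
    {F : MySpan C A B → MySpan C A' B'}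
    (hF : ∀ S T : MySpan C A B, SpanLe E S T → SpanLe E (F S) (F T))
    {S T : MySpan C A B} (h : SpanSim E S T) : SpanSim E (F S) (F T) := by
  induction h with
  | rel _ _ h => exact .rel _ _ (hF _ _ h)
  | refl _ => exact .refl _
  | symm _ _ _ ih => exact .symm _ _ ih
  | trans _ _ _ _ _ ih₁ ih₂ => exact .trans _ _ _ ih₁ ih₂

/-- If `E` is a stable system, the equivalence relation `∼_E` is compatible with horizontal
composition of spans: `(f,g) ∼_E (f',g')` and `(h,k) ∼_E (h',k')` imply
`(h,k)∘(f,g) ∼_E (h',k')∘(f',g')`. -/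
theorem simE_compatible_with_comp [HasPullbacks C] (E : MorphismProperty C)
    (hE : IsStableSystem E) {A B X : C} (S S' : MySpan C A B) (T T' : MySpan C B X)
    (h₁ : SpanSim E S S') (h₂ : SpanSim E T T') :
    SpanSim E (S.comp T) (S'.comp T') := by
  exact .trans _ _ _
    (SpanSim.map (F := fun S => S.comp T) (fun _ _ h => SpanLe.comp_right hE h T) h₁)
    (SpanSim.map (F := fun T => S'.comp T) (fun _ _ h => SpanLe.comp_left hE S' h) h₂)
end

section
/- Let E be a stable system of morphisms in a category C with chosen pullbacks, and let (f,g),(h,k) : A ⇸ B be spans with apexes D and D'. Then (f,g) ∼_E (h,k) if and only if there exist an object W and morphisms x : W → D and y : W → D', both lying in E, such that f∘x = h∘y and g∘x = k∘y. -/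
open CategoryTheory CategoryTheory.Limits

universe v u

variable {C : Type u} [Category.{v} C]

/-- Common refinements compose along the pullback over the middle apex. -/
theorem common_refinement_trans [HasPullbacks C] {E : MorphismProperty C}
    (hE : IsStableSystem E) {A B : C} {S T U : MySpan C A B}
    (hST : ∃ (W : C) (x : W ⟶ S.apex) (y : W ⟶ T.apex), E x ∧ E y ∧
      x ≫ S.left = y ≫ T.left ∧ x ≫ S.right = y ≫ T.right)
    (hTU : ∃ (W : C) (x : W ⟶ T.apex) (y : W ⟶ U.apex), E x ∧ E y ∧
      x ≫ T.left = y ≫ U.left ∧ x ≫ T.right = y ≫ U.right) :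
    ∃ (W : C) (x : W ⟶ S.apex) (y : W ⟶ U.apex), E x ∧ E y ∧
      x ≫ S.left = y ≫ U.left ∧ x ≫ S.right = y ≫ U.right := by
  obtain ⟨W, x, y, hx, hy, hl, hr⟩ := hST
  obtain ⟨W', x', y', hx', hy', hl', hr'⟩ := hTU
  have hP := IsPullback.of_hasPullback y x'
  refine ⟨pullback y x', pullback.fst y x' ≫ x, pullback.snd y x' ≫ y',
    hE.comp_mem _ _ (hE.pullback_stable _ _ _ _ hP hx') hx,
    hE.comp_mem _ _ (hE.pullback_stable _ _ _ _ hP.flip hy) hy', ?_, ?_⟩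
  · rw [Category.assoc, Category.assoc, hl, ← hl', pullback.condition_assoc]
  · rw [Category.assoc, Category.assoc, hr, ← hr', pullback.condition_assoc]

/-- For a stable system `E`, `(f,g) ∼_E (h,k)` iff there is a common refinement: an object `W`
and morphisms `x`, `y` in `E` to the two apexes making both triangles commute. -/
theorem simE_iff_common_refinement [HasPullbacks C] (E : MorphismProperty C)
    (hE : IsStableSystem E) {A B : C} (S T : MySpan C A B) :
    SpanSim E S T ↔
      ∃ (W : C) (x : W ⟶ S.apex) (y : W ⟶ T.apex), E x ∧ E y ∧
        x ≫ S.left = y ≫ T.left ∧ x ≫ S.right = y ≫ T.right := by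
  constructor
  · intro h
    induction h with
    | rel S T h =>
      obtain ⟨x, hx, hl, hr⟩ := h
      exact ⟨S.apex, 𝟙 _, x, hE.of_isIso _ inferInstance, hx, by simp [hl], by simp [hr]⟩
    | refl S =>
      exact ⟨S.apex, 𝟙 _, 𝟙 _, hE.of_isIso _ inferInstance, hE.of_isIso _ inferInstance,
        rfl, rfl⟩
    | symm S T _ ih =>
      obtain ⟨W, x, y, hx, hy, hl, hr⟩ := ih
      exact ⟨W, y, x, hy, hx, hl.symm, hr.symm⟩
    | trans S T U _ _ ihST ihTU => exact common_refinement_trans hE ihST ihTU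
  · rintro ⟨W, x, y, hx, hy, hl, hr⟩
    exact .trans _ ⟨W, x ≫ S.left, x ≫ S.right⟩ _
      (.symm _ _ (.rel _ _ ⟨x, hx, rfl, rfl⟩)) (.rel _ _ ⟨y, hy, hl.symm, hr.symm⟩)
end

section
/- Let E be a stable system of morphisms in a category C with chosen pullbacks. Then ∼_E is allegorical (i.e., for every morphism f : A → B one has (1_A, f) ∼_E (p₁, f∘p₂), where (p₁,p₂) is the kernel pair of f) if and only if for every effective retraction r (a split epimorphism r : X → Y for which there exists r' : X → Y such that (r,r') is a kernel pair of some morphism out of Y) there exists a morphism z lying in E such that r∘z also lies in E. -/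
open CategoryTheory CategoryTheory.Limits

universe v u

variable {C : Type u} [Category.{v} C]

/-- For a stable system, `∼_E`-related spans have a common lower bound with respect to `≤_E`. -/
theorem SpanSim.exists_common_lower_bound [HasPullbacks C] {E : MorphismProperty C}
    (hE : IsStableSystem E) {A B : C} {S T : MySpan C A B} (h : SpanSim E S T) :
    ∃ U : MySpan C A B, SpanLe E U S ∧ SpanLe E U T := by
  have le_refl (S : MySpan C A B) : SpanLe E S S :=
    ⟨𝟙 _, hE.of_isIso _ inferInstance, Category.id_comp _, Category.id_comp _⟩
  have le_trans {S T U : MySpan C A B} : SpanLe E S T → SpanLe E T U → SpanLe E S U := by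
    rintro ⟨x, hx, hxl, hxr⟩ ⟨y, hy, hyl, hyr⟩
    exact ⟨x ≫ y, hE.comp_mem _ _ hx hy, by rw [Category.assoc, hyl, hxl],
      by rw [Category.assoc, hyr, hxr]⟩
  induction h with
  | rel S T h => exact ⟨S, le_refl S, h⟩
  | refl S => exact ⟨S, le_refl S, le_refl S⟩
  | symm S T _ ih =>
    obtain ⟨U, h₁, h₂⟩ := ih
    exact ⟨U, h₂, h₁⟩
  | trans S T R _ _ ih₁ ih₂ =>
    obtain ⟨U, hUS, x, hx, hxl, hxr⟩ := ih₁
    obtain ⟨V, ⟨y, hy, hyl, hyr⟩, hVR⟩ := ih₂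
    have hP := IsPullback.of_hasPullback x y
    refine ⟨⟨pullback x y, pullback.fst x y ≫ U.left, pullback.fst x y ≫ U.right⟩,
      le_trans ⟨pullback.fst x y, hE.pullback_stable _ _ _ _ hP hy, rfl, rfl⟩ hUS,
      le_trans ⟨pullback.snd x y, hE.pullback_stable _ _ _ _ hP.flip hx, ?_, ?_⟩ hVR⟩
    · rw [← hyl, ← hxl, pullback.condition_assoc]
    · rw [← hyr, ← hxr, pullback.condition_assoc]

/-- For a stable system, `(1_A, f) ∼_E (p₁, f∘p₂)` if and only if some `z` in `E` has
`p₁∘z` in `E`. -/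
theorem spanSim_kernelPair_iff [HasPullbacks C] {E : MorphismProperty C}
    (hE : IsStableSystem E) {A B : C} (f : A ⟶ B) :
    SpanSim E (⟨A, 𝟙 A, f⟩ : MySpan C A B)
        ⟨pullback f f, pullback.fst f f, pullback.snd f f ≫ f⟩ ↔
      ∃ (W : C) (z : W ⟶ pullback f f), E z ∧ E (z ≫ pullback.fst f f) := by
  constructor
  · intro h
    obtain ⟨U, ⟨a, ha, hal, -⟩, z, hz, hzl, -⟩ := h.exists_common_lower_bound hE
    dsimp only at a z hal hzl
    refine ⟨U.apex, z, hz, ?_⟩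
    rwa [hzl, ← hal, Category.comp_id]
  · rintro ⟨W, z, hz, hzp⟩
    let U : MySpan C A B := ⟨W, z ≫ pullback.fst f f, (z ≫ pullback.fst f f) ≫ f⟩
    have hU₁ : SpanLe E U ⟨A, 𝟙 A, f⟩ := ⟨z ≫ pullback.fst f f, hzp, Category.comp_id _, rfl⟩
    have hU₂ : SpanLe E U ⟨pullback f f, pullback.fst f f, pullback.snd f f ≫ f⟩ :=
      ⟨z, hz, rfl, by simp [U, pullback.condition]⟩
    exact .trans _ _ _ (.symm _ _ (.rel _ _ hU₁)) (.rel _ _ hU₂)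

/-- For a stable system `E`, the relation `∼_E` is allegorical if and only if for every
effective retraction `r` (a split epimorphism `r : X ⟶ Y` such that `(r,r')` is a kernel
pair of some morphism `q` out of `Y`) there is a morphism `z` in `E` with `z ≫ r ∈ E`. -/
theorem simE_allegorical_iff_effective_retractions [HasPullbacks C]
    (E : MorphismProperty C) (hE : IsStableSystem E) :
    SimAllegorical E ↔
      ∀ {X Y Z : C} (r : X ⟶ Y) (s : Y ⟶ X), s ≫ r = 𝟙 Y →
        ∀ (r' : X ⟶ Y) (q : Y ⟶ Z), IsKernelPair q r r' →
          ∃ (W : C) (z : W ⟶ X), E z ∧ E (z ≫ r) := by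
  constructor
  · intro h X Y Z r s _ r' q hq
    obtain ⟨W, z, hz, hzp⟩ := (spanSim_kernelPair_iff hE q).1 (h q)
    refine ⟨W, z ≫ hq.isoPullback.inv, hE.comp_mem _ _ hz (hE.of_isIso _ inferInstance), ?_⟩
    rwa [Category.assoc, hq.isoPullback_inv_fst]
  · intro h A B f
    exact (spanSim_kernelPair_iff hE f).2 <|
      h (pullback.fst f f) (pullback.lift (𝟙 A) (𝟙 A) rfl) (pullback.lift_fst _ _ _)
        (pullback.snd f f) f (IsPullback.of_hasPullback f f)
end

section
/- Let E be a stable system of morphisms in a category C with chosen pullbacks that contains all split epimorphisms. Then ∼_E is allegorical: for every morphism f : A → B one has (1_A, f) ∼_E (p₁, f∘p₂), where (p₁,p₂) is the kernel pair of f. -/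
open CategoryTheory CategoryTheory.Limits

universe v u

variable {C : Type u} [Category.{v} C]

/-- If a stable system `E` contains all split epimorphisms, then `∼_E` is allegorical:
for every `f : A ⟶ B` one has `(1_A, f) ∼_E (p₁, f∘p₂)` with `(p₁,p₂)` the kernel pair
of `f`. -/
theorem simE_allegorical_of_splitEpi_mem [HasPullbacks C]
    (E : MorphismProperty C) (hE : IsStableSystem E)
    (hsplit : ∀ {X Y : C} (r : X ⟶ Y), IsSplitEpi r → E r) :
    ∀ {A B : C} (f : A ⟶ B),
      SpanSim E (⟨A, 𝟙 A, f⟩ : MySpan C A B)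
        ⟨pullback f f, pullback.fst f f, pullback.snd f f ≫ f⟩ := by
  intro A B f
  have : IsSplitEpi (pullback.fst f f) := ⟨⟨⟨pullback.diagonal f, pullback.diagonal_fst f⟩⟩⟩
  exact .symm _ _ (.rel _ _ ⟨pullback.fst f f, hsplit _ this, Category.comp_id _,
    pullback.condition⟩)
end

section
/- Let C be a category with kernel pairs and let E, M be classes of morphisms of C such that: every morphism f of C factors as f = m∘e with e ∈ E and m ∈ M; M is stable under pullback; every morphism lying in both E and M is an isomorphism; and E is closed under composition with isomorphisms. Then every split epimorphism of C lies in E if and only if every morphism in M is a monomorphism. -/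
open CategoryTheory CategoryTheory.Limits

universe v u

/-- Let `C` have kernel pairs and let `E`, `M` be classes of morphisms such that every
morphism factors as `m ∘ e` with `e ∈ E`, `m ∈ M`; `M` is stable under pullback;
`E ∩ M ⊆ Iso`; and `E` is closed under composition with isomorphisms (on either side).
Then all split epimorphisms lie in `E` iff all morphisms in `M` are monomorphisms. -/
theorem splitEpi_in_E_iff_M_mono {C : Type u} [Category.{v} C]
    (E M : MorphismProperty C)
    (hkp : ∀ {X Y : C} (f : X ⟶ Y), HasPullback f f)
    (hfac : ∀ {X Y : C} (f : X ⟶ Y),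
      ∃ (Z : C) (e : X ⟶ Z) (m : Z ⟶ Y), E e ∧ M m ∧ e ≫ m = f)
    (hMstable : ∀ {P X Y Z : C} (fst : P ⟶ X) (snd : P ⟶ Y) (f : X ⟶ Z) (g : Y ⟶ Z),
      IsPullback fst snd f g → M g → M fst)
    (hEM : ∀ {X Y : C} (f : X ⟶ Y), E f → M f → IsIso f)
    (hEcompIso : ∀ {X Y Z : C} (e : X ⟶ Y) (i : Y ⟶ Z), E e → IsIso i → E (e ≫ i))
    (hIsoCompE : ∀ {X Y Z : C} (i : X ⟶ Y) (e : Y ⟶ Z), IsIso i → E e → E (i ≫ e)) :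
    (∀ {X Y : C} (r : X ⟶ Y), IsSplitEpi r → E r) ↔
      (∀ {X Y : C} (m : X ⟶ Y), M m → Mono m) := by
  constructor
  · intro hE X Y m hm
    have := hkp m
    have sq := IsPullback.of_hasPullback m m
    have : IsSplitEpi (pullback.fst m m) :=
      ⟨⟨⟨pullback.lift (𝟙 X) (𝟙 X) rfl, pullback.lift_fst _ _ _⟩⟩⟩
    have : IsIso (pullback.fst m m) := hEM _ (hE _ inferInstance) (hMstable _ _ _ _ sq hm)
    exact IsKernelPair.mono_of_isIso_fst sq
  · intro hM X Y r hr
    obtain ⟨Z, e, m, he, hm, rfl⟩ := hfac r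
    have := hM m hm
    have : IsSplitEpi m :=
      ⟨⟨⟨section_ (e ≫ m) ≫ e, by rw [Category.assoc, IsSplitEpi.id]⟩⟩⟩
    exact hEcompIso e m he (isIso_of_mono_of_isSplitEpi m)
end

section
/- Let (E,M) be a stable orthogonal factorization system on a finitely complete category C. Then the relation ∼_E is allegorical (i.e., for every morphism f : A → B one has (1_A, f) ∼_E (p₁, f∘p₂), with (p₁,p₂) the kernel pair of f) if and only if every morphism in M is a monomorphism (equivalently, every split epimorphism of C lies in E). -/
open CategoryTheory CategoryTheory.Limits

universe v u

variable {C : Type u} [Category.{v} C]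

/-- A stable orthogonal factorization system `(E,M)` on `C`: both classes contain all
isomorphisms and are closed under composition, every morphism factors as `m ∘ e`,
there are unique diagonal fillers, and `E` is stable under pullback. -/
structure StableOFS (C : Type u) [Category.{v} C] where
  E : MorphismProperty C
  M : MorphismProperty C
  E_iso : ∀ {X Y : C} (f : X ⟶ Y), IsIso f → E f
  M_iso : ∀ {X Y : C} (f : X ⟶ Y), IsIso f → M f
  E_comp : ∀ {X Y Z : C} (f : X ⟶ Y) (g : Y ⟶ Z), E f → E g → E (f ≫ g)
  M_comp : ∀ {X Y Z : C} (f : X ⟶ Y) (g : Y ⟶ Z), M f → M g → M (f ≫ g)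
  fac : ∀ {X Y : C} (f : X ⟶ Y),
    ∃ (Z : C) (e : X ⟶ Z) (m : Z ⟶ Y), E e ∧ M m ∧ e ≫ m = f
  lift : ∀ {X Y X' Y' : C} (e : X ⟶ Y) (m : X' ⟶ Y') (u : X ⟶ X') (v : Y ⟶ Y'),
    E e → M m → u ≫ m = e ≫ v → ∃! d : Y ⟶ X', e ≫ d = u ∧ d ≫ m = v
  E_stable : ∀ {P X Y Z : C} (fst : P ⟶ X) (snd : P ⟶ Y) (f : X ⟶ Z) (g : Y ⟶ Z),
    IsPullback fst snd f g → E g → E fst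

namespace StableOFS

/-- The class `E` is right cancellable: if `e` and `e ≫ g` lie in `E`, so does `g`. -/
lemma E_of_comp_left (F : StableOFS C) {X Y Z : C} {e : X ⟶ Y} {g : Y ⟶ Z}
    (he : F.E e) (heg : F.E (e ≫ g)) : F.E g := by
  obtain ⟨W, e₂, m, he₂, hm, rfl⟩ := F.fac g
  have he' : F.E (e ≫ e₂) := F.E_comp _ _ he he₂
  obtain ⟨d, ⟨hd₁, hd₂⟩, -⟩ := F.lift (e ≫ e₂ ≫ m) m (e ≫ e₂) (𝟙 Z) heg hm (by simp)
  have hmd : m ≫ d = 𝟙 W :=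
    (F.lift (e ≫ e₂) m (e ≫ e₂) m he' hm rfl).unique
      ⟨by simpa using hd₁, by simp [hd₂]⟩ ⟨by simp, by simp⟩
  exact F.E_comp _ _ he₂ (F.E_iso m ⟨d, hmd, hd₂⟩)

lemma mono_of_M_of_E_fst [HasPullbacks C] (F : StableOFS C) {X Y : C} {m : X ⟶ Y}
    (hm : F.M m) (hp : F.E (pullback.fst m m)) : Mono m := by
  obtain ⟨d, ⟨hd, -⟩, -⟩ := F.lift _ m (pullback.snd m m) m hp hm pullback.condition.symm
  have hd' : d = 𝟙 X := by
    have h := congrArg (pullback.lift (𝟙 X) (𝟙 X) rfl ≫ ·) hd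
    simpa only [pullback.lift_fst_assoc, pullback.lift_snd, Category.id_comp] using h
  rw [hd', Category.comp_id] at hd
  refine ⟨fun a b hab => ?_⟩
  rw [← pullback.lift_fst a b hab, hd, pullback.lift_snd]

lemma E_of_isSplitEpi (F : StableOFS C) (hF : ∀ {X Y : C} (m : X ⟶ Y), F.M m → Mono m)
    {X Y : C} (r : X ⟶ Y) [IsSplitEpi r] : F.E r := by
  obtain ⟨Z, e, m, he, hm, hr⟩ := F.fac r
  have := hF m hm
  have hs : (section_ r ≫ e) ≫ m = 𝟙 Y := by simp [hr]
  have hm' : IsIso m := ⟨section_ r ≫ e, by rw [← cancel_mono m, Category.assoc, hs]; simp, hs⟩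
  exact hr ▸ F.E_comp _ _ he (F.E_iso m hm')

end StableOFS

/-- Pulling back the span `S` along the graph `⟨1, f⟩` of `f` amounts to taking the equalizer of
`S.left ≫ f` and `S.right`; this is the resulting morphism to `A`. -/
noncomputable def MySpan.restrictToGraph [HasEqualizers C] {A B : C} (f : A ⟶ B)
    (S : MySpan C A B) : equalizer (S.left ≫ f) S.right ⟶ A :=
  equalizer.ι _ _ ≫ S.left

lemma SpanLe.exists_restrictToGraph [HasEqualizers C] {F : StableOFS C} {A B : C} (f : A ⟶ B)
    {S T : MySpan C A B} (h : SpanLe F.E S T) :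
    ∃ y : equalizer (S.left ≫ f) S.right ⟶ equalizer (T.left ≫ f) T.right,
      F.E y ∧ y ≫ T.restrictToGraph f = S.restrictToGraph f := by
  obtain ⟨x, hx, hl, hr⟩ := h
  have hy : (equalizer.ι (S.left ≫ f) S.right ≫ x) ≫ T.left ≫ f =
      (equalizer.ι (S.left ≫ f) S.right ≫ x) ≫ T.right := by
    simp only [Category.assoc, hr, reassoc_of% hl, equalizer.condition]
  refine ⟨equalizer.lift _ hy, ?_, by simp [MySpan.restrictToGraph, hl]⟩
  refine F.E_stable _ (equalizer.ι _ _) (equalizer.ι _ _) x ⟨⟨by simp⟩, ⟨?_⟩⟩ hx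
  refine PullbackCone.IsLimit.mk _ (fun s => equalizer.lift s.snd ?_) (fun s => ?_) (fun s => ?_)
    (fun s k _ hk => ?_)
  · rw [← hl, ← hr, Category.assoc, ← s.condition_assoc, ← s.condition_assoc,
      equalizer.condition]
  · ext
    simp [s.condition]
  · simp
  · ext
    simpa using hk

lemma SpanSim.E_restrictToGraph_iff [HasEqualizers C] {F : StableOFS C} {A B : C} (f : A ⟶ B)
    {S T : MySpan C A B} (h : SpanSim F.E S T) :
    F.E (S.restrictToGraph f) ↔ F.E (T.restrictToGraph f) := by
  induction h with
  | rel S T h =>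
    obtain ⟨y, hy, hyT⟩ := h.exists_restrictToGraph f
    rw [← hyT]
    exact ⟨F.E_of_comp_left hy, F.E_comp _ _ hy⟩
  | refl => rfl
  | symm _ _ _ ih => exact ih.symm
  | trans _ _ _ _ _ ih₁ ih₂ => exact ih₁.trans ih₂

lemma SimAllegorical.E_fst [HasFiniteLimits C] {F : StableOFS C} (h : SimAllegorical F.E)
    {A B : C} (f : A ⟶ B) : F.E (pullback.fst f f) := by
  have hK := ((h f).E_restrictToGraph_iff f).1
    (F.E_comp _ _ (F.E_iso _ (equalizer.ι_of_eq (Category.id_comp f))) (F.E_iso _ inferInstance))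
  exact F.E_of_comp_left (F.E_iso _ (equalizer.ι_of_eq pullback.condition)) hK

lemma SimAllegorical.of_E_fst [HasPullbacks C] {E : MorphismProperty C}
    (h : ∀ {A B : C} (f : A ⟶ B), E (pullback.fst f f)) : SimAllegorical E := fun f =>
  .symm _ _ (.rel _ _ ⟨pullback.fst f f, h f, by simp, pullback.condition⟩)

/-- For a stable orthogonal factorization system `(E,M)` on a finitely complete category,
`∼_E` is allegorical iff every morphism in `M` is a monomorphism, equivalently iff every
split epimorphism lies in `E`. -/
theorem simE_allegorical_iff_M_mono [HasFiniteLimits C] (F : StableOFS C) :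
    (SimAllegorical F.E ↔ ∀ {X Y : C} (m : X ⟶ Y), F.M m → Mono m) ∧
      ((∀ {X Y : C} (m : X ⟶ Y), F.M m → Mono m) ↔
        ∀ {X Y : C} (r : X ⟶ Y), IsSplitEpi r → F.E r) := by
  have hfst (h : ∀ {X Y : C} (r : X ⟶ Y), IsSplitEpi r → F.E r) {X Y : C} (f : X ⟶ Y) :
      F.E (pullback.fst f f) :=
    h _ ⟨⟨⟨pullback.lift (𝟙 X) (𝟙 X) rfl, pullback.lift_fst _ _ _⟩⟩⟩
  refine ⟨⟨fun h _ _ m hm => F.mono_of_M_of_E_fst hm (h.E_fst m), fun h => ?_⟩,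
    fun h _ _ r _ => F.E_of_isSplitEpi h r, fun h _ _ m hm => F.mono_of_M_of_E_fst hm (hfst h m)⟩
  exact SimAllegorical.of_E_fst (hfst fun r _ => F.E_of_isSplitEpi h r)
end

section
/- Lax distributivity of span composition over meet: let C have binary products and chosen pullbacks, let (f,g),(p,q) : A ⇸ B be spans with apexes D, F and (h,k) : B ⇸ C a span with apex E. Let U be the pullback of ⟨f,g⟩ and ⟨p,q⟩ with projections u₁ : U → D, u₂ : U → F; let W be the pullback of g∘u₁ and h with projections w₁ : W → U, w₂ : W → E (so (h,k)∘((f,g)∧(p,q)) = (f∘u₁∘w₁, k∘w₂)); let P be the pullback of g and h with projections h' : P → D, g' : P → E; let Q be the pullback of q and h with projections h'' : Q → F, q' : Q → E; and let V be the pullback of ⟨f∘h', k∘g'⟩ : P → A×C and ⟨p∘h'', k∘q'⟩ : Q → A×C with projections v₁ : V → P, v₂ : V → Q. Then there exists a morphism d : W → V such that f∘h'∘v₁∘d = f∘u₁∘w₁ and k∘g'∘v₁∘d = k∘w₂. -/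
open CategoryTheory CategoryTheory.Limits

universe v u

/-- Lax distributivity of span composition over meet: there is a canonical 2-cell
`d : (h,k)∘((f,g)∧(p,q)) ⟶ ((h,k)∘(f,g)) ∧ ((h,k)∘(p,q))` of spans `A ⇸ X`.
Here `U` is the pullback of `⟨f,g⟩, ⟨p,q⟩` (projections `u₁,u₂`), `W` the pullback of
`g∘u₁, h` (projections `w₁,w₂`), `P` the pullback of `g, h` (projections `h',g'`),
`Q` the pullback of `q, h` (projections `h'',q'`), and `V` the pullback of
`⟨f∘h', k∘g'⟩, ⟨p∘h'', k∘q'⟩` (projections `v₁,v₂`). -/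
theorem lax_distributivity_two_cell {C : Type u} [Category.{v} C]
    [HasPullbacks C] [HasBinaryProducts C]
    {A B X D F E : C} (f : D ⟶ A) (g : D ⟶ B) (p : F ⟶ A) (q : F ⟶ B)
    (h : E ⟶ B) (k : E ⟶ X) :
    ∃ d : pullback (pullback.fst (prod.lift f g) (prod.lift p q) ≫ g) h ⟶
        pullback (prod.lift (pullback.fst g h ≫ f) (pullback.snd g h ≫ k))
          (prod.lift (pullback.fst q h ≫ p) (pullback.snd q h ≫ k)),
      d ≫ pullback.fst (prod.lift (pullback.fst g h ≫ f) (pullback.snd g h ≫ k))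
            (prod.lift (pullback.fst q h ≫ p) (pullback.snd q h ≫ k)) ≫
          pullback.fst g h ≫ f =
        pullback.fst (pullback.fst (prod.lift f g) (prod.lift p q) ≫ g) h ≫
          pullback.fst (prod.lift f g) (prod.lift p q) ≫ f ∧
      d ≫ pullback.fst (prod.lift (pullback.fst g h ≫ f) (pullback.snd g h ≫ k))
            (prod.lift (pullback.fst q h ≫ p) (pullback.snd q h ≫ k)) ≫
          pullback.snd g h ≫ k =
        pullback.snd (pullback.fst (prod.lift f g) (prod.lift p q) ≫ g) h ≫ k := by
  have eqA : pullback.fst (prod.lift f g) (prod.lift p q) ≫ f =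
      pullback.snd (prod.lift f g) (prod.lift p q) ≫ p := by
    simpa [prod.lift_fst, prod.lift_snd] using
      pullback.condition (f := prod.lift f g) (g := prod.lift p q) =≫ prod.fst
  have eqB : pullback.fst (prod.lift f g) (prod.lift p q) ≫ g =
      pullback.snd (prod.lift f g) (prod.lift p q) ≫ q := by
    simpa [prod.lift_fst, prod.lift_snd] using
      pullback.condition (f := prod.lift f g) (g := prod.lift p q) =≫ prod.snd
  let u₁ := pullback.fst (prod.lift f g) (prod.lift p q)
  let u₂ := pullback.snd (prod.lift f g) (prod.lift p q)
  let w₁ := pullback.fst (u₁ ≫ g) h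
  let w₂ := pullback.snd (u₁ ≫ g) h
  have hw : w₁ ≫ u₁ ≫ g = w₂ ≫ h := pullback.condition
  have hP : (w₁ ≫ u₁) ≫ g = w₂ ≫ h := (Category.assoc _ _ _).trans hw
  have hQ : (w₁ ≫ u₂) ≫ q = w₂ ≫ h :=
    (Category.assoc _ _ _).trans ((w₁ ≫= eqB).symm.trans hw)
  have hA : w₁ ≫ u₁ ≫ f = w₁ ≫ u₂ ≫ p := w₁ ≫= eqA
  refine ⟨pullback.lift (pullback.lift (w₁ ≫ u₁) w₂ hP) (pullback.lift (w₁ ≫ u₂) w₂ hQ) ?_,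
    ?_, ?_⟩
  · ext <;>
      simp [prod.lift_fst, prod.lift_snd, pullback.lift_fst_assoc, pullback.lift_snd_assoc, hA]
  · rw [pullback.lift_fst_assoc, pullback.lift_fst_assoc, Category.assoc]
  · rw [pullback.lift_fst_assoc, pullback.lift_snd_assoc]
end

section
/- Freyd modularity morphism for spans: let C have binary products and chosen pullbacks, and let (f,g) : A ⇸ B, (h,k) : B ⇸ C, (m,n) : A ⇸ C be spans with apexes D, E, G. Let P be the pullback of g and h with projections h' : P → D, g' : P → E (so (h,k)∘(f,g) = (f∘h', k∘g')); let Q be the pullback of n and k with projections k' : Q → G, n' : Q → E (so (k,h)∘(m,n) = (m∘k', h∘n')); let T be the pullback of ⟨f,g⟩ : D → A×B and ⟨m∘k', h∘n'⟩ : Q → A×B with projections t₁ : T → D, t₂ : T → Q; let R be the pullback of g∘t₁ and h with projections r₁ : R → T, r₂ : R → E; and let S be the pullback of ⟨f∘h', k∘g'⟩ : P → A×C and ⟨m,n⟩ : G → A×C with projections s₁ : S → P, s₂ : S → G. Then there exists a morphism c : S → R such that f∘t₁∘r₁∘c = f∘h'∘s₁ and k∘r₂∘c = k∘g'∘s₁.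 -/
open CategoryTheory CategoryTheory.Limits

universe v u

/-- The Freyd modularity morphism of spans: there is a canonical 2-cell
`c : ((h,k)∘(f,g)) ∧ (m,n) ⟶ (h,k)∘((f,g) ∧ ((h,k)°∘(m,n)))` of spans `A ⇸ X`.
Here `P` is the pullback of `g, h` (projections `h',g'`), `Q` the pullback of `n, k`
(projections `k',n'`), `T` the pullback of `⟨f,g⟩, ⟨m∘k', h∘n'⟩` (projections `t₁,t₂`),
`R` the pullback of `g∘t₁, h` (projections `r₁,r₂`), and `S` the pullback of
`⟨f∘h', k∘g'⟩, ⟨m,n⟩` (projections `s₁,s₂`). -/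
theorem freyd_modularity_two_cell {C : Type u} [Category.{v} C]
    [HasPullbacks C] [HasBinaryProducts C]
    {A B X D E G : C} (f : D ⟶ A) (g : D ⟶ B) (h : E ⟶ B) (k : E ⟶ X)
    (m : G ⟶ A) (n : G ⟶ X) :
    ∃ c : pullback (prod.lift (pullback.fst g h ≫ f) (pullback.snd g h ≫ k))
            (prod.lift m n) ⟶
          pullback
            (pullback.fst (prod.lift f g)
              (prod.lift (pullback.fst n k ≫ m) (pullback.snd n k ≫ h)) ≫ g) h,
      c ≫ pullback.fst
            (pullback.fst (prod.lift f g)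
              (prod.lift (pullback.fst n k ≫ m) (pullback.snd n k ≫ h)) ≫ g) h ≫
          pullback.fst (prod.lift f g)
            (prod.lift (pullback.fst n k ≫ m) (pullback.snd n k ≫ h)) ≫ f =
        pullback.fst (prod.lift (pullback.fst g h ≫ f) (pullback.snd g h ≫ k))
            (prod.lift m n) ≫ pullback.fst g h ≫ f ∧
      c ≫ pullback.snd
            (pullback.fst (prod.lift f g)
              (prod.lift (pullback.fst n k ≫ m) (pullback.snd n k ≫ h)) ≫ g) h ≫ k =
        pullback.fst (prod.lift (pullback.fst g h ≫ f) (pullback.snd g h ≫ k))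
            (prod.lift m n) ≫ pullback.snd g h ≫ k := by
  have compA := congrArg (· ≫ prod.fst) (pullback.condition
    (f := prod.lift (pullback.fst g h ≫ f) (pullback.snd g h ≫ k)) (g := prod.lift m n))
  have compX := congrArg (· ≫ prod.snd) (pullback.condition
    (f := prod.lift (pullback.fst g h ≫ f) (pullback.snd g h ≫ k)) (g := prod.lift m n))
  simp only [Category.assoc, prod.lift_fst, prod.lift_snd] at compA compX
  set s₁ := pullback.fst (prod.lift (pullback.fst g h ≫ f) (pullback.snd g h ≫ k))
    (prod.lift m n)
  set s₂ := pullback.snd (prod.lift (pullback.fst g h ≫ f) (pullback.snd g h ≫ k))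
    (prod.lift m n)
  have toQ : s₂ ≫ n = (s₁ ≫ pullback.snd g h) ≫ k := by
    rw [Category.assoc, compX]
  have toT : (s₁ ≫ pullback.fst g h) ≫ prod.lift f g = pullback.lift _ _ toQ ≫
      prod.lift (pullback.fst n k ≫ m) (pullback.snd n k ≫ h) := by
    apply prod.hom_ext
    · simp only [Category.assoc, prod.lift_fst, pullback.lift_fst_assoc, compA]
    · simp only [Category.assoc, prod.lift_snd, pullback.lift_snd_assoc, pullback.condition]
  have toR : pullback.lift _ _ toT ≫ pullback.fst (prod.lift f g)
      (prod.lift (pullback.fst n k ≫ m) (pullback.snd n k ≫ h)) ≫ g =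
      (s₁ ≫ pullback.snd g h) ≫ h := by
    simp only [Category.assoc, pullback.lift_fst_assoc, pullback.condition]
  refine ⟨pullback.lift _ _ toR, ?_, ?_⟩
  · simp only [Category.assoc, pullback.lift_fst_assoc]
  · simp only [Category.assoc, pullback.lift_snd_assoc]
end

section
/- Let C have binary products and chosen pullbacks and let ∼ be an equivalence relation on spans of C that relates any two vertically isomorphic spans and is inv-compatible, comp-compatible, and allegorical. If there exists a morphism u : D → F with p∘u = f and q∘u = g between spans (f,g),(p,q) : A ⇸ B with apexes D, F, then (f,g)∧(p,q) ∼ (f,g). In particular, (f,g)∧(f,g) ∼ (f,g) for every span (f,g). -/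
open CategoryTheory CategoryTheory.Limits

universe v u

variable {C : Type u} [Category.{v} C]

section SpanRelation

variable [HasPullbacks C] [HasBinaryProducts C]
variable (r : ∀ ⦃A B : C⦄, MySpan C A B → MySpan C A B → Prop)

/-- `r` relates any two vertically isomorphic spans. -/
def RelatesVertIso : Prop :=
  ∀ {A B : C} (S T : MySpan C A B) (u : S.apex ⟶ T.apex),
    IsIso u → u ≫ T.left = S.left → u ≫ T.right = S.right → r S T

/-- `r` is inv-compatible: `(f,g) ∼ (f',g')` implies `(g,f) ∼ (g',f')`. -/
def InvCompatible : Prop :=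
  ∀ {A B : C} (S T : MySpan C A B), r S T → r S.symm T.symm

/-- `r` is comp-compatible: `(f,g) ∼ (f',g')` implies `(h,k)∘(f,g) ∼ (h,k)∘(f',g')`. -/
def CompCompatible : Prop :=
  ∀ {A B X : C} (S T : MySpan C A B) (U : MySpan C B X), r S T → r (S.comp U) (T.comp U)

/-- `r` is meet-compatible: `(f,g) ∼ (f',g')` implies `(f,⟨f,g⟩) ∼ (f',⟨f',g'⟩)`. -/
def MeetCompatible : Prop :=
  ∀ {A B : C} (S T : MySpan C A B), r S T →
    r (⟨S.apex, S.left, prod.lift S.left S.right⟩ : MySpan C A (A ⨯ B))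
      ⟨T.apex, T.left, prod.lift T.left T.right⟩

/-- `r` is allegorical: `(1_A,f) ∼ (f,f)∘(1_A,f)` for every morphism `f : A ⟶ B`. -/
def RelAllegorical : Prop :=
  ∀ {A B : C} (f : A ⟶ B),
    r (⟨A, 𝟙 A, f⟩ : MySpan C A B)
      (MySpan.comp (⟨A, 𝟙 A, f⟩ : MySpan C A B) (⟨A, f, f⟩ : MySpan C B B))

end SpanRelation

namespace MySpan

/-- The span `(f, k∘g)`. -/
def mapRight {A B X : C} (S : MySpan C A B) (k : B ⟶ X) : MySpan C A X :=
  ⟨S.apex, S.left, S.right ≫ k⟩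

end MySpan

section SpanRelation

variable [HasPullbacks C] {r : ∀ ⦃A B : C⦄, MySpan C A B → MySpan C A B → Prop}

/-- Any pullback square computes the horizontal composite up to `∼`. -/
theorem RelatesVertIso.comp_of_isPullback (hiso : RelatesVertIso r) {A B X : C}
    (S : MySpan C A B) (T : MySpan C B X) {P : C} {fst : P ⟶ S.apex} {snd : P ⟶ T.apex}
    (h : IsPullback fst snd S.right T.left) :
    r ⟨P, fst ≫ S.left, snd ≫ T.right⟩ (S.comp T) := by
  refine hiso _ _ h.isoPullback.hom (Iso.isIso_hom _) ?_ ?_ <;> simp [MySpan.comp]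

/-- Comp-compatibility with composites computed by arbitrary pullback squares. -/
theorem CompCompatible.of_isPullback (hequiv : ∀ A B : C, Equivalence (@r A B))
    (hiso : RelatesVertIso r) (hcomp : CompCompatible r) {A B X : C}
    {S S' : MySpan C A B} (hS : r S S') (T : MySpan C B X)
    {P P' : C} {fst : P ⟶ S.apex} {snd : P ⟶ T.apex} {fst' : P' ⟶ S'.apex} {snd' : P' ⟶ T.apex}
    (h : IsPullback fst snd S.right T.left) (h' : IsPullback fst' snd' S'.right T.left) :
    r ⟨P, fst ≫ S.left, snd ≫ T.right⟩ ⟨P', fst' ≫ S'.left, snd' ≫ T.right⟩ :=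
  (hequiv _ _).trans (hiso.comp_of_isPullback S T h) <|
    (hequiv _ _).trans (hcomp S S' T hS) <|
      (hequiv _ _).symm (hiso.comp_of_isPullback S' T h')

theorem CompCompatible.mapRight (hequiv : ∀ A B : C, Equivalence (@r A B))
    (hiso : RelatesVertIso r) (hcomp : CompCompatible r) {A B X : C}
    {S S' : MySpan C A B} (hS : r S S') (k : B ⟶ X) : r (S.mapRight k) (S'.mapRight k) := by
  simpa [MySpan.mapRight] using
    hcomp.of_isPullback hequiv hiso hS ⟨B, 𝟙 B, k⟩
      (IsPullback.of_horiz_isIso (fst := 𝟙 _) (snd := S.right) ⟨by simp⟩)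
      (IsPullback.of_horiz_isIso (fst := 𝟙 _) (snd := S'.right) ⟨by simp⟩)

/-- The allegorical law for `w`, inverted and pulled back along `u`. -/
theorem RelAllegorical.pullback_fst (hequiv : ∀ A B : C, Equivalence (@r A B))
    (hiso : RelatesVertIso r) (hinv : InvCompatible r) (hcomp : CompCompatible r)
    (hall : RelAllegorical r) {D F Z : C} (v : D ⟶ Z) (w : F ⟶ Z) (u : D ⟶ F) (hu : u ≫ w = v) :
    r (⟨D, v, 𝟙 D⟩ : MySpan C Z D)
      ⟨pullback v w, pullback.fst v w ≫ v, pullback.fst v w⟩ := by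
  subst hu
  have hker : r (⟨F, w, 𝟙 F⟩ : MySpan C Z F)
      ⟨pullback w w, pullback.snd w w ≫ w, pullback.fst w w⟩ := by
    have h := hiso.comp_of_isPullback (⟨F, 𝟙 F, w⟩ : MySpan C F Z) ⟨F, w, w⟩
      (IsPullback.of_hasPullback w w)
    simpa [MySpan.symm] using
      hinv _ _ ((hequiv _ _).trans (hall w) ((hequiv _ _).symm h))
  let l : pullback (u ≫ w) w ⟶ pullback w w :=
    pullback.lift (pullback.fst _ _ ≫ u) (pullback.snd _ _) (by simp [pullback.condition])
  have hl : IsPullback l (pullback.fst (u ≫ w) w) (pullback.fst w w) u := by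
    refine IsPullback.of_right (h₁₁ := l) (h₁₂ := pullback.snd w w) (h₂₁ := u) (h₂₂ := w)
      (v₁₁ := pullback.fst (u ≫ w) w) (v₁₂ := pullback.fst w w) (v₁₃ := w)
      ?_ ?_ (IsPullback.of_hasPullback w w).flip
    · simpa [l, pullback.lift_snd] using (IsPullback.of_hasPullback (u ≫ w) w).flip
    · simp [l, pullback.lift_fst]
  have h := hcomp.of_isPullback hequiv hiso hker (⟨D, u, 𝟙 D⟩ : MySpan C F D)
    (IsPullback.of_vert_isIso (fst := u) (snd := 𝟙 D) ⟨by simp⟩) hl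
  simpa [l, pullback.lift_snd_assoc, pullback.condition] using h

end SpanRelation

/-- If `∼` is an equivalence relation on spans relating vertically isomorphic spans and
inv-compatible, comp-compatible and allegorical, then the existence of a 2-cell
`u : (f,g) → (p,q)` yields `(f,g)∧(p,q) ∼ (f,g)`; in particular `(f,g)∧(f,g) ∼ (f,g)`. -/
theorem meet_sim_of_two_cell [HasPullbacks C] [HasBinaryProducts C]
    (r : ∀ ⦃A B : C⦄, MySpan C A B → MySpan C A B → Prop)
    (hequiv : ∀ A B : C, Equivalence (fun S T : MySpan C A B => r S T))
    (hiso : RelatesVertIso r) (hinv : InvCompatible r) (hcomp : CompCompatible r)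
    (hall : RelAllegorical r) :
    (∀ {A B : C} (S T : MySpan C A B) (u : S.apex ⟶ T.apex),
      u ≫ T.left = S.left → u ≫ T.right = S.right → r (S.meet T) S) ∧
    (∀ {A B : C} (S : MySpan C A B), r (S.meet S) S) := by
  have key : ∀ {A B : C} (S T : MySpan C A B) (u : S.apex ⟶ T.apex),
      u ≫ T.left = S.left → u ≫ T.right = S.right → r (S.meet T) S := by
    intro A B S T u hl hr
    have h := hall.pullback_fst hequiv hiso hinv hcomp (prod.lift S.left S.right)
      (prod.lift T.left T.right) u (by ext <;> simp [hl, hr, prod.lift_fst, prod.lift_snd])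
    have h₁ := hinv _ _ (hcomp.mapRight hequiv hiso h S.right)
    have h₂ := hinv _ _ (hcomp.mapRight hequiv hiso h₁ prod.fst)
    refine (hequiv A B).symm ?_
    simpa [MySpan.mapRight, MySpan.symm, MySpan.meet, prod.lift_fst] using h₂
  exact ⟨key, fun S => key S S (𝟙 _) (Category.id_comp _) (Category.id_comp _)⟩
end

section
/- Let C have binary products and chosen pullbacks and let ∼ be an equivalence relation on spans of C that relates any two vertically isomorphic spans and is inv-compatible, comp-compatible, and allegorical. If spans (f,g),(p,q) : A ⇸ B with apexes D, F admit morphisms u : D → F with p∘u = f, q∘u = g and v : F → D with f∘v = p, g∘v = q, then (f,g) ∼ (p,q). -/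
open CategoryTheory CategoryTheory.Limits

universe v u

variable {C : Type u} [Category.{v} C]

section SpanCongruence

variable [HasPullbacks C] {r : ∀ ⦃A B : C⦄, MySpan C A B → MySpan C A B → Prop}

/-- Composing both sides of a related pair with `(1, m)` on the codomain side. -/
theorem rel_postcomp_hom (hequiv : ∀ A B : C, Equivalence (fun S T : MySpan C A B => r S T))
    (hiso : RelatesVertIso r) (hcomp : CompCompatible r)
    {A B X : C} {S T : MySpan C A B} (m : B ⟶ X) (h : r S T) :
    r (⟨S.apex, S.left, S.right ≫ m⟩ : MySpan C A X) ⟨T.apex, T.left, T.right ≫ m⟩ := by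
  have unit : ∀ W : MySpan C A B, r (W.comp ⟨B, 𝟙 B, m⟩) ⟨W.apex, W.left, W.right ≫ m⟩ := by
    intro W
    refine hiso _ _ (pullback.fst W.right (𝟙 B))
      (inferInstanceAs (IsIso (pullback.fst W.right (𝟙 B)))) rfl ?_
    change pullback.fst W.right (𝟙 B) ≫ W.right ≫ m = pullback.snd W.right (𝟙 B) ≫ m
    rw [pullback.condition_assoc, Category.id_comp]
  exact (hequiv _ _).trans ((hequiv _ _).symm (unit S))
    ((hequiv _ _).trans (hcomp _ _ _ h) (unit T))

/-- An inv- and comp-compatible relation is also compatible with composition on the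
domain side. -/
theorem rel_precomp (hequiv : ∀ A B : C, Equivalence (fun S T : MySpan C A B => r S T))
    (hiso : RelatesVertIso r) (hinv : InvCompatible r) (hcomp : CompCompatible r)
    {A B X : C} (U : MySpan C X A) {S T : MySpan C A B} (h : r S T) :
    r (U.comp S) (U.comp T) := by
  have swap : ∀ W : MySpan C A B, r (U.comp W) (W.symm.comp U.symm).symm := fun W =>
    hiso _ _ (pullbackSymmetry U.right W.left).hom
      (inferInstanceAs (IsIso (pullbackSymmetry U.right W.left).hom))
      (pullbackSymmetry_hom_comp_snd_assoc U.right W.left U.left)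
      (pullbackSymmetry_hom_comp_fst_assoc U.right W.left W.right)
  exact (hequiv _ _).trans (swap S)
    ((hequiv _ _).trans (hinv _ _ (hcomp _ _ _ (hinv _ _ h))) ((hequiv _ _).symm (swap T)))

/-- If `u` is a morphism of spans `S ⟶ T`, then `S` is related to the span on the pullback of
`⟨S.left, S.right⟩` and `⟨T.left, T.right⟩` with left leg from `S` and right leg from `T`. -/
theorem rel_pullback_of_two_cell [HasBinaryProducts C]
    (hequiv : ∀ A B : C, Equivalence (fun S T : MySpan C A B => r S T))
    (hiso : RelatesVertIso r) (hinv : InvCompatible r) (hcomp : CompCompatible r)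
    (hall : RelAllegorical r) {A B : C} (S T : MySpan C A B)
    (u : S.apex ⟶ T.apex) (hu₁ : u ≫ T.left = S.left) (hu₂ : u ≫ T.right = S.right) :
    r S ⟨pullback (prod.lift S.left S.right) (prod.lift T.left T.right),
      pullback.fst (prod.lift S.left S.right) (prod.lift T.left T.right) ≫ S.left,
      pullback.snd (prod.lift S.left S.right) (prod.lift T.left T.right) ≫ T.right⟩ := by
  have huk : u ≫ prod.lift T.left T.right = prod.lift S.left S.right := by
    rw [prod.comp_lift, hu₁, hu₂]
  set h := prod.lift S.left S.right
  set k := prod.lift T.left T.right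
  have hkT : k ≫ prod.snd = T.right := prod.lift_snd _ _
  have hrel := rel_postcomp_hom hequiv hiso hcomp prod.snd
    (rel_precomp hequiv hiso hinv hcomp ⟨S.apex, S.left, u⟩ (hall k))
  refine (hequiv _ _).trans ((hequiv _ _).symm (hiso _ _ (pullback.fst u (𝟙 _))
    (inferInstanceAs (IsIso (pullback.fst u (𝟙 T.apex)))) rfl ?_))
    ((hequiv _ _).trans hrel ((hequiv _ _).symm ?_))
  · change pullback.fst u (𝟙 _) ≫ S.right = (pullback.snd u (𝟙 _) ≫ k) ≫ prod.snd
    rw [Category.assoc, hkT, ← hu₂, pullback.condition_assoc, Category.id_comp]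
  · let w : pullback h k ⟶ pullback k k :=
      pullback.lift (pullback.fst h k ≫ u) (pullback.snd h k)
        (by rw [Category.assoc, huk, pullback.condition])
    have hw₁ : w ≫ pullback.fst k k = pullback.fst h k ≫ u := pullback.lift_fst _ _ _
    have hw₂ : w ≫ pullback.snd k k = pullback.snd h k := pullback.lift_snd _ _ _
    have hbig : IsPullback (w ≫ pullback.snd k k) (pullback.fst h k) k (u ≫ k) := by
      rw [hw₂, huk]
      exact (IsPullback.of_hasPullback h k).flip
    have hsq : IsPullback (pullback.fst h k) w u (pullback.fst k k ≫ 𝟙 T.apex) := by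
      rw [Category.comp_id]
      exact (IsPullback.of_right hbig hw₁
        (IsPullback.of_hasPullback k k).flip).flip
    refine hiso (⟨pullback h k, pullback.fst h k ≫ S.left, pullback.snd h k ≫ T.right⟩ :
        MySpan C A B)
      ⟨pullback u (pullback.fst k k ≫ 𝟙 T.apex), pullback.fst _ _ ≫ S.left,
        (pullback.snd _ _ ≫ pullback.snd k k ≫ k) ≫ prod.snd⟩
      hsq.isoPullback.hom inferInstance ?_ ?_
    · exact hsq.isoPullback_hom_fst_assoc S.left
    · change hsq.isoPullback.hom ≫ (pullback.snd _ _ ≫ pullback.snd k k ≫ k) ≫ prod.snd = _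
      simp only [Category.assoc, hkT]
      rw [hsq.isoPullback_hom_snd_assoc, ← hw₂, Category.assoc]

end SpanCongruence

/-- If `∼` is an equivalence relation on spans relating vertically isomorphic spans and
inv-compatible, comp-compatible and allegorical, then two spans admitting 2-cells in both
directions are `∼`-related. -/
theorem sim_of_two_cells_both_ways [HasPullbacks C] [HasBinaryProducts C]
    (r : ∀ ⦃A B : C⦄, MySpan C A B → MySpan C A B → Prop)
    (hequiv : ∀ A B : C, Equivalence (fun S T : MySpan C A B => r S T))
    (hiso : RelatesVertIso r) (hinv : InvCompatible r) (hcomp : CompCompatible r)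
    (hall : RelAllegorical r)
    {A B : C} (S T : MySpan C A B)
    (u : S.apex ⟶ T.apex) (hu₁ : u ≫ T.left = S.left) (hu₂ : u ≫ T.right = S.right)
    (v : T.apex ⟶ S.apex) (hv₁ : v ≫ S.left = T.left) (hv₂ : v ≫ S.right = T.right) :
    r S T := by
  refine (hequiv _ _).trans
    (rel_pullback_of_two_cell hequiv hiso hinv hcomp hall S T u hu₁ hu₂)
    ((hequiv _ _).trans (hiso _ _ (pullbackSymmetry _ _).hom inferInstance ?_ ?_)
      ((hequiv _ _).symm
        (rel_pullback_of_two_cell hequiv hiso hinv hcomp hall T S v hv₁ hv₂)))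
  · have h := pullback.condition (f := prod.lift S.left S.right)
      (g := prod.lift T.left T.right) =≫ prod.fst
    simpa only [Category.assoc, prod.lift_fst, pullbackSymmetry_hom_comp_fst_assoc] using h.symm
  · have h := pullback.condition (f := prod.lift S.left S.right)
      (g := prod.lift T.left T.right) =≫ prod.snd
    simpa only [Category.assoc, prod.lift_snd, pullbackSymmetry_hom_comp_snd_assoc] using h
end

section
/- Freyd's modular law holds up to a compatible allegorical equivalence: let C have binary products and chosen pullbacks and let ∼ be an equivalence relation on spans of C that relates any two vertically isomorphic spans and is inv-compatible, comp-compatible, meet-compatible, and allegorical. Then for all spans r = (f,g) : A ⇸ B, s = (h,k) : B ⇸ C, t = (m,n) : A ⇸ C one has ((s∘r)∧t) ∧ (s∘(r∧(s°∘t))) ∼ (s∘r)∧t, where s° = (k,h) : C ⇸ B and all composites and meets are computed via the chosen pullbacks and products. -/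
open CategoryTheory CategoryTheory.Limits

universe v u

variable {C : Type u} [Category.{v} C]

/-- Reassociated form of an equation `f ≫ g = h`. -/
theorem comp_eq_assoc {W X Y Z : C} {f : W ⟶ X} {g : X ⟶ Y} {h : W ⟶ Y} (w : f ≫ g = h)
    (k : Y ⟶ Z) : f ≫ g ≫ k = h ≫ k := by
  rw [← w, Category.assoc]

namespace MySpan

section Meet

variable [HasPullbacks C] [HasBinaryProducts C] {A B : C}

/-- The first projection from the apex of a meet. -/
noncomputable def meetFst (S T : MySpan C A B) : (S.meet T).apex ⟶ S.apex :=
  pullback.fst (prod.lift S.left S.right) (prod.lift T.left T.right)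

/-- The second projection from the apex of a meet. -/
noncomputable def meetSnd (S T : MySpan C A B) : (S.meet T).apex ⟶ T.apex :=
  pullback.snd (prod.lift S.left S.right) (prod.lift T.left T.right)

/-- The universal morphism into the apex of a meet. -/
noncomputable def meetLift {S T : MySpan C A B} {W : C} (x : W ⟶ S.apex) (y : W ⟶ T.apex)
    (hl : x ≫ S.left = y ≫ T.left) (hr : x ≫ S.right = y ≫ T.right) :
    W ⟶ (S.meet T).apex :=
  pullback.lift x y (by ext <;> simpa [prod.lift_fst, prod.lift_snd])

@[simp]
theorem meetLift_fst {S T : MySpan C A B} {W : C} (x : W ⟶ S.apex) (y : W ⟶ T.apex)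
    (hl : x ≫ S.left = y ≫ T.left) (hr : x ≫ S.right = y ≫ T.right) :
    meetLift x y hl hr ≫ meetFst S T = x :=
  pullback.lift_fst _ _ _

@[simp]
theorem meetLift_snd {S T : MySpan C A B} {W : C} (x : W ⟶ S.apex) (y : W ⟶ T.apex)
    (hl : x ≫ S.left = y ≫ T.left) (hr : x ≫ S.right = y ≫ T.right) :
    meetLift x y hl hr ≫ meetSnd S T = y :=
  pullback.lift_snd _ _ _

@[simp]
theorem meetLift_fst_assoc {S T : MySpan C A B} {W Z : C}
    (x : W ⟶ S.apex) (y : W ⟶ T.apex)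
    (hl : x ≫ S.left = y ≫ T.left) (hr : x ≫ S.right = y ≫ T.right)
    (z : S.apex ⟶ Z) :
    meetLift x y hl hr ≫ meetFst S T ≫ z = x ≫ z :=
  comp_eq_assoc (meetLift_fst x y hl hr) z

@[simp]
theorem meetLift_snd_assoc {S T : MySpan C A B} {W Z : C}
    (x : W ⟶ S.apex) (y : W ⟶ T.apex)
    (hl : x ≫ S.left = y ≫ T.left) (hr : x ≫ S.right = y ≫ T.right)
    (z : T.apex ⟶ Z) :
    meetLift x y hl hr ≫ meetSnd S T ≫ z = y ≫ z :=
  comp_eq_assoc (meetLift_snd x y hl hr) z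

theorem meet_hom_ext {S T : MySpan C A B} {W : C} {x y : W ⟶ (S.meet T).apex}
    (h₁ : x ≫ meetFst S T = y ≫ meetFst S T) (h₂ : x ≫ meetSnd S T = y ≫ meetSnd S T) :
    x = y :=
  pullback.hom_ext h₁ h₂

theorem meet_left (S T : MySpan C A B) : (S.meet T).left = meetFst S T ≫ S.left := rfl

theorem meet_right (S T : MySpan C A B) : (S.meet T).right = meetFst S T ≫ S.right := rfl

theorem meetSnd_left (S T : MySpan C A B) :
    meetSnd S T ≫ T.left = meetFst S T ≫ S.left := by
  have h := pullback.condition (f := prod.lift S.left S.right) (g := prod.lift T.left T.right)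
  have hproj := (congrArg (· ≫ prod.fst) h).symm
  simp only [Category.assoc, prod.lift_fst] at hproj
  exact hproj

theorem meetSnd_right (S T : MySpan C A B) :
    meetSnd S T ≫ T.right = meetFst S T ≫ S.right := by
  have h := pullback.condition (f := prod.lift S.left S.right) (g := prod.lift T.left T.right)
  have hproj := (congrArg (· ≫ prod.snd) h).symm
  simp only [Category.assoc, prod.lift_snd] at hproj
  exact hproj

end Meet

section Comp

variable [HasPullbacks C] {A B X : C}

/-- The first projection from the apex of a composite. -/
noncomputable def compFst (S : MySpan C A B) (T : MySpan C B X) : (S.comp T).apex ⟶ S.apex :=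
  pullback.fst S.right T.left

/-- The second projection from the apex of a composite. -/
noncomputable def compSnd (S : MySpan C A B) (T : MySpan C B X) : (S.comp T).apex ⟶ T.apex :=
  pullback.snd S.right T.left

/-- The universal morphism into the apex of a composite. -/
noncomputable def compLift {S : MySpan C A B} {T : MySpan C B X} {W : C}
    (x : W ⟶ S.apex) (y : W ⟶ T.apex) (h : x ≫ S.right = y ≫ T.left) :
    W ⟶ (S.comp T).apex :=
  pullback.lift x y h

@[simp]
theorem compLift_fst {S : MySpan C A B} {T : MySpan C B X} {W : C}
    (x : W ⟶ S.apex) (y : W ⟶ T.apex) (h : x ≫ S.right = y ≫ T.left) :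
    compLift x y h ≫ compFst S T = x :=
  pullback.lift_fst _ _ _

@[simp]
theorem compLift_snd {S : MySpan C A B} {T : MySpan C B X} {W : C}
    (x : W ⟶ S.apex) (y : W ⟶ T.apex) (h : x ≫ S.right = y ≫ T.left) :
    compLift x y h ≫ compSnd S T = y :=
  pullback.lift_snd _ _ _

@[simp]
theorem compLift_fst_assoc {S : MySpan C A B} {T : MySpan C B X} {W Z : C}
    (x : W ⟶ S.apex) (y : W ⟶ T.apex)
    (h : x ≫ S.right = y ≫ T.left)
    (z : S.apex ⟶ Z) :
    compLift x y h ≫ compFst S T ≫ z = x ≫ z :=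
  comp_eq_assoc (compLift_fst x y h) z

@[simp]
theorem compLift_snd_assoc {S : MySpan C A B} {T : MySpan C B X} {W Z : C}
    (x : W ⟶ S.apex) (y : W ⟶ T.apex)
    (h : x ≫ S.right = y ≫ T.left)
    (z : T.apex ⟶ Z) :
    compLift x y h ≫ compSnd S T ≫ z = y ≫ z :=
  comp_eq_assoc (compLift_snd x y h) z

theorem comp_hom_ext {S : MySpan C A B} {T : MySpan C B X} {W : C}
    {x y : W ⟶ (S.comp T).apex}
    (h₁ : x ≫ compFst S T = y ≫ compFst S T) (h₂ : x ≫ compSnd S T = y ≫ compSnd S T) :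
    x = y :=
  pullback.hom_ext h₁ h₂

theorem comp_left (S : MySpan C A B) (T : MySpan C B X) :
    (S.comp T).left = compFst S T ≫ S.left := rfl

theorem comp_right (S : MySpan C A B) (T : MySpan C B X) :
    (S.comp T).right = compSnd S T ≫ T.right := rfl

theorem compSnd_left (S : MySpan C A B) (T : MySpan C B X) :
    compSnd S T ≫ T.left = compFst S T ≫ S.right :=
  pullback.condition.symm

end Comp

end MySpan

open MySpan

theorem RelatesVertIso.of_inverse
    {r : ∀ ⦃A B : C⦄, MySpan C A B → MySpan C A B → Prop}
    (hiso : RelatesVertIso r) {A B : C} {S T : MySpan C A B}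
    (u : S.apex ⟶ T.apex) (v : T.apex ⟶ S.apex) (huv : u ≫ v = 𝟙 _) (hvu : v ≫ u = 𝟙 _)
    (hl : u ≫ T.left = S.left) (hr : u ≫ T.right = S.right) : r S T :=
  hiso S T u ⟨v, huv, hvu⟩ hl hr

section Congruence

variable [HasPullbacks C] [HasBinaryProducts C]
variable {r : ∀ ⦃A B : C⦄, MySpan C A B → MySpan C A B → Prop}

theorem RelatesVertIso.meet_comm (hiso : RelatesVertIso r) {A B : C} (S T : MySpan C A B) :
    r (S.meet T) (T.meet S) := by
  refine hiso.of_inverse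
    (meetLift (meetSnd S T) (meetFst S T) (meetSnd_left S T) (meetSnd_right S T))
    (meetLift (meetSnd T S) (meetFst T S) (meetSnd_left T S) (meetSnd_right T S)) ?_ ?_ ?_ ?_
  · apply meet_hom_ext <;> simp
  · apply meet_hom_ext <;> simp
  · simp [meet_left, meetSnd_left]
  · simp [meet_right, meetSnd_right]

theorem RelatesVertIso.meet_assoc (hiso : RelatesVertIso r) {A B : C} (S T U : MySpan C A B) :
    r ((S.meet T).meet U) (S.meet (T.meet U)) := by
  have hl := meetSnd_left S (T.meet U)
  have hr := meetSnd_right S (T.meet U)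
  rw [meet_left] at hl
  rw [meet_right] at hr
  refine hiso.of_inverse
    (meetLift (meetFst (S.meet T) U ≫ meetFst S T)
      (meetLift (meetFst (S.meet T) U ≫ meetSnd S T) (meetSnd (S.meet T) U)
        (by simp [meet_left, meetSnd_left]) (by simp [meet_right, meetSnd_right]))
      (by simp [meet_left, meetSnd_left]) (by simp [meet_right, meetSnd_right]))
    (meetLift (meetLift (meetFst S (T.meet U)) (meetSnd S (T.meet U) ≫ meetFst T U)
        (by simp [hl]) (by simp [hr]))
      (meetSnd S (T.meet U) ≫ meetSnd T U)
      (by simp [meet_left, meetSnd_left, hl]) (by simp [meet_right, meetSnd_right, hr]))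
    ?_ ?_ ?_ ?_
  · apply meet_hom_ext
    · apply meet_hom_ext <;> simp
    · simp
  · apply meet_hom_ext
    · simp
    · apply meet_hom_ext <;> simp
  · simp [meet_left]
  · simp [meet_right]

/-- Postcomposing the right leg with a morphism preserves `r`. -/
theorem CompCompatible.map_right
    (hequiv : ∀ A B : C, Equivalence (fun S T : MySpan C A B => r S T))
    (hiso : RelatesVertIso r) (hcomp : CompCompatible r) {A B X : C} {S T : MySpan C A B}
    (h : r S T) (b : B ⟶ X) :
    r (⟨S.apex, S.left, S.right ≫ b⟩ : MySpan C A X) ⟨T.apex, T.left, T.right ≫ b⟩ := by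
  have key (U : MySpan C A B) :
      r (U.comp ⟨B, 𝟙 B, b⟩) (⟨U.apex, U.left, U.right ≫ b⟩ : MySpan C A X) := by
    have h := compSnd_left U (⟨B, 𝟙 B, b⟩ : MySpan C B X)
    rw [Category.comp_id] at h
    refine hiso.of_inverse (compFst _ _) (compLift (𝟙 _) U.right (by simp)) ?_ (by simp) rfl ?_
    · apply comp_hom_ext <;> simp [h]
    · simp [comp_right, h]
  exact (hequiv _ _).trans ((hequiv _ _).symm (key S))
    ((hequiv _ _).trans (hcomp S T ⟨B, 𝟙 B, b⟩ h) (key T))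

/-- A span is related to its pullback along the first projection of the kernel pair of any
morphism through which its left leg factors. -/
theorem RelAllegorical.kernelPair
    (hequiv : ∀ A B : C, Equivalence (fun S T : MySpan C A B => r S T))
    (hiso : RelatesVertIso r) (hinv : InvCompatible r) (hcomp : CompCompatible r)
    (hall : RelAllegorical r) {A B P Z : C} (u : P ⟶ Z) (a : Z ⟶ A) (b : P ⟶ B) :
    r (⟨P, u ≫ a, b⟩ : MySpan C A B)
      ⟨pullback u u, pullback.fst u u ≫ u ≫ a, pullback.fst u u ≫ b⟩ := by
  have h₁ := hcomp.map_right hequiv hiso (hinv _ _ (hall u)) b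
  have h₂ := hinv _ _ (hcomp.map_right hequiv hiso (hinv _ _ h₁) a)
  simpa [MySpan.symm, comp, pullback.condition_assoc] using h₂

theorem RelAllegorical.meet_self
    (hequiv : ∀ A B : C, Equivalence (fun S T : MySpan C A B => r S T))
    (hiso : RelatesVertIso r) (hinv : InvCompatible r) (hcomp : CompCompatible r)
    (hall : RelAllegorical r) {A B : C} (S : MySpan C A B) : r (S.meet S) S := by
  have h := hall.kernelPair hequiv hiso hinv hcomp (prod.lift S.left S.right) prod.fst S.right
  rw [prod.lift_fst] at h
  exact (hequiv _ _).symm h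

theorem MeetCompatible.meet_congr_left
    (hcomp : CompCompatible r) (hmeet : MeetCompatible r) {A B : C}
    {S S' : MySpan C A B} (T : MySpan C A B) (h : r S S') : r (S.meet T) (S'.meet T) := by
  have key (U : MySpan C A B) :
      comp (⟨U.apex, U.left, prod.lift U.left U.right⟩ : MySpan C A (A ⨯ B))
        ⟨T.apex, prod.lift T.left T.right, T.right⟩ = U.meet T :=
    congrArg (MySpan.mk _ _) (meetSnd_right U T)
  rw [← key S, ← key S']
  exact hcomp _ _ _ (hmeet S S' h)

theorem MeetCompatible.meet_congr_right
    (hequiv : ∀ A B : C, Equivalence (fun S T : MySpan C A B => r S T))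
    (hiso : RelatesVertIso r) (hcomp : CompCompatible r) (hmeet : MeetCompatible r) {A B : C}
    (S : MySpan C A B) {T T' : MySpan C A B} (h : r T T') : r (S.meet T) (S.meet T') :=
  (hequiv _ _).trans (hiso.meet_comm S T)
    ((hequiv _ _).trans (hmeet.meet_congr_left hcomp S h) (hiso.meet_comm T' S))

/-- The modular law in its symmetric form `(S∘R)∧T ∼ (S∘(R∧(S°∘T)))∧T`. -/
theorem RelAllegorical.meet_modular
    (hequiv : ∀ A B : C, Equivalence (fun S T : MySpan C A B => r S T))
    (hiso : RelatesVertIso r) (hinv : InvCompatible r) (hcomp : CompCompatible r)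
    (hall : RelAllegorical r) {A B X : C}
    (R : MySpan C A B) (S : MySpan C B X) (T : MySpan C A X) :
    r ((R.comp S).meet T) (((R.meet (T.comp S.symm)).comp S).meet T) := by
  let M := (R.comp S).meet T
  let d : M.apex ⟶ R.apex := meetFst _ _ ≫ compFst _ _
  let e : M.apex ⟶ S.apex := meetFst _ _ ≫ compSnd _ _
  let t : M.apex ⟶ T.apex := meetSnd _ _
  have hde : e ≫ S.left = d ≫ R.right := by simp [d, e, compSnd_left]
  have hdt : t ≫ T.left = d ≫ R.left := by simp [d, t, meetSnd_left, comp_left]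
  have het : t ≫ T.right = e ≫ S.right := by simp [e, t, meetSnd_right, comp_right]
  have hM := hall.kernelPair hequiv hiso hinv hcomp d R.left M.right
  rw [show d ≫ R.left = M.left from Category.assoc _ _ _] at hM
  refine (hequiv _ _).trans hM ?_
  have lift {W : C} (x : W ⟶ R.apex) (y : W ⟶ S.apex) (z : W ⟶ T.apex)
      (hyx : y ≫ S.left = x ≫ R.right) (hzx : z ≫ T.left = x ≫ R.left)
      (hzy : z ≫ T.right = y ≫ S.right) : ∃ w : W ⟶ M.apex, w ≫ d = x ∧ w ≫ e = y ∧ w ≫ t = z :=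
    ⟨meetLift (compLift x y hyx.symm) z (by simp [comp_left, hzx]) (by simp [comp_right, hzy]),
      by simp [d], by simp [e], by simp [t]⟩
  have hom_ext {W : C} {x y : W ⟶ M.apex} (h₁ : x ≫ d = y ≫ d) (h₂ : x ≫ e = y ≫ e)
      (h₃ : x ≫ t = y ≫ t) : x = y :=
    meet_hom_ext (comp_hom_ext (by simpa [d] using h₁) (by simpa [e] using h₂)) h₃
  have hMl : M.left = d ≫ R.left := (Category.assoc _ _ _).symm
  have hMr : M.right = e ≫ S.right := (Category.assoc _ _ _).symm
  clear_value d e t M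
  let p := pullback.fst d d
  let q := pullback.snd d d
  have hpq : q ≫ d = p ≫ d := pullback.condition.symm
  let V := T.comp S.symm
  let a : V.apex ⟶ T.apex := compFst T S.symm
  let b : V.apex ⟶ S.apex := compSnd T S.symm
  have hab : b ≫ S.right = a ≫ T.right := compSnd_left T S.symm
  have hVl : V.left = a ≫ T.left := rfl
  have hVr : V.right = b ≫ S.left := rfl
  have liftV {W : C} (x : W ⟶ T.apex) (y : W ⟶ S.apex) (h : x ≫ T.right = y ≫ S.right) :
      ∃ w : W ⟶ V.apex, w ≫ a = x ∧ w ≫ b = y :=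
    ⟨compLift (T := S.symm) x y h, compLift_fst _ _ _, compLift_snd _ _ _⟩
  have hom_extV {W : C} {x y : W ⟶ V.apex} (h₁ : x ≫ a = y ≫ a) (h₂ : x ≫ b = y ≫ b) :
      x = y := comp_hom_ext h₁ h₂
  change r _ (((R.meet V).comp S).meet T)
  clear_value a b V
  let U := R.meet V
  let Q := U.comp S
  let c := meetFst Q T ≫ compFst U S
  have hVl' : meetSnd R V ≫ a ≫ T.left = meetFst R V ≫ R.left := hVl ▸ meetSnd_left R V
  have hVr' : meetSnd R V ≫ b ≫ S.left = meetFst R V ≫ R.right := hVr ▸ meetSnd_right R V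
  have hU : compSnd U S ≫ S.left = compFst U S ≫ meetFst R V ≫ R.right := compSnd_left U S
  have hQl : meetSnd Q T ≫ T.left = meetFst Q T ≫ (compFst U S ≫ meetFst R V ≫ R.left) :=
    meetSnd_left Q T
  have hQr : meetSnd Q T ≫ T.right = meetFst Q T ≫ compSnd U S ≫ S.right :=
    meetSnd_right Q T
  obtain ⟨v₀, hd₀, he₀, ht₀⟩ := lift (c ≫ meetFst R V) (meetFst Q T ≫ compSnd U S)
    (meetSnd Q T) (by simp [c, hU]) (by simp [c, hQl]) (by simp [hQr])
  obtain ⟨v₁, hd₁, he₁, ht₁⟩ := lift (c ≫ meetFst R V) (c ≫ meetSnd R V ≫ b)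
    (c ≫ meetSnd R V ≫ a) (by simp [hVr']) (by simp [hVl']) (by simp [hab])
  obtain ⟨v, hvp, hvq⟩ : ∃ v : (Q.meet T).apex ⟶ pullback d d, v ≫ p = v₀ ∧ v ≫ q = v₁ :=
    ⟨pullback.lift v₀ v₁ (hd₀.trans hd₁.symm), pullback.lift_fst _ _ _, pullback.lift_snd _ _ _⟩
  obtain ⟨uV, huVa, huVb⟩ := liftV (q ≫ t) (q ≫ e) (by simp [het])
  let uU : pullback d d ⟶ U.apex := meetLift (p ≫ d) uV
    (by simp [hVl, comp_eq_assoc huVa, hdt, comp_eq_assoc hpq])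
    (by simp [hVr, comp_eq_assoc huVb, hde, comp_eq_assoc hpq])
  have huUd : uU ≫ meetFst R V = p ≫ d := meetLift_fst _ _ _ _
  have huUV : uU ≫ meetSnd R V = uV := meetLift_snd _ _ _ _
  let uQ : pullback d d ⟶ Q.apex := compLift uU (p ≫ e)
    (by simp [U, meet_right, comp_eq_assoc huUd, hde])
  have huQU : uQ ≫ compFst U S = uU := compLift_fst _ _ _
  have huQe : uQ ≫ compSnd U S = p ≫ e := compLift_snd _ _ _
  let u : pullback d d ⟶ (Q.meet T).apex := meetLift uQ (p ≫ t)
    (by simp [Q, U, comp_left, meet_left, comp_eq_assoc huQU, comp_eq_assoc huUd, hdt])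
    (by simp [Q, comp_right, comp_eq_assoc huQe, het])
  have huQ : u ≫ meetFst Q T = uQ := meetLift_fst _ _ _ _
  have hut : u ≫ meetSnd Q T = p ≫ t := meetLift_snd _ _ _ _
  have huc : u ≫ c = uU := by simp [c, comp_eq_assoc huQ, huQU]
  have hvu : v ≫ uU = c := by
    refine meet_hom_ext (S := R) (T := V) ?_ (hom_extV ?_ ?_)
    · simp [huUd, comp_eq_assoc hvp, hd₀]
    · simp [huUV, huVa, comp_eq_assoc hvq, ht₁]
    · simp [huUV, huVb, comp_eq_assoc hvq, he₁]
  clear_value uU uQ u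
  refine hiso.of_inverse u v ?_ ?_ ?_ ?_
  · refine pullback.hom_ext (hom_ext ?_ ?_ ?_) (hom_ext ?_ ?_ ?_)
    · change ((u ≫ v) ≫ p) ≫ d = (𝟙 _ ≫ p) ≫ d
      simp [hvp, hd₀, comp_eq_assoc huc, huUd]
    · change ((u ≫ v) ≫ p) ≫ e = (𝟙 _ ≫ p) ≫ e
      simp [hvp, he₀, comp_eq_assoc huQ, huQe]
    · change ((u ≫ v) ≫ p) ≫ t = (𝟙 _ ≫ p) ≫ t
      simp [hvp, ht₀, hut]
    · change ((u ≫ v) ≫ q) ≫ d = (𝟙 _ ≫ q) ≫ d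
      simp [hvq, hd₁, comp_eq_assoc huc, huUd, hpq]
    · change ((u ≫ v) ≫ q) ≫ e = (𝟙 _ ≫ q) ≫ e
      simp [hvq, he₁, comp_eq_assoc huc, comp_eq_assoc huUV, huVb]
    · change ((u ≫ v) ≫ q) ≫ t = (𝟙 _ ≫ q) ≫ t
      simp [hvq, ht₁, comp_eq_assoc huc, comp_eq_assoc huUV, huVa]
  · refine meet_hom_ext (S := Q) (comp_hom_ext (S := U) ?_ ?_) ?_
    · simp [huQ, huQU, hvu, c]
    · simp [huQ, huQe, comp_eq_assoc hvp, he₀]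
    · simp [hut, comp_eq_assoc hvp, ht₀]
  · change u ≫ meetFst Q T ≫ compFst U S ≫ meetFst R V ≫ R.left = p ≫ M.left
    rw [comp_eq_assoc huQ, comp_eq_assoc huQU, comp_eq_assoc huUd, hMl, Category.assoc]
  · change u ≫ meetFst Q T ≫ compSnd U S ≫ S.right = p ≫ M.right
    rw [comp_eq_assoc huQ, comp_eq_assoc huQe, hMr, Category.assoc]

end Congruence

/-- Freyd's modular law up to a compatible allegorical equivalence: for spans
`R : A ⇸ B`, `S : B ⇸ X`, `T : A ⇸ X` one has
`((S∘R)∧T) ∧ (S∘(R∧(S°∘T))) ∼ (S∘R)∧T`, all composites and meets being computed via the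
chosen pullbacks and products. -/
theorem freyd_modular_law_up_to_sim [HasPullbacks C] [HasBinaryProducts C]
    (r : ∀ ⦃A B : C⦄, MySpan C A B → MySpan C A B → Prop)
    (hequiv : ∀ A B : C, Equivalence (fun S T : MySpan C A B => r S T))
    (hiso : RelatesVertIso r) (hinv : InvCompatible r) (hcomp : CompCompatible r)
    (hmeet : MeetCompatible r) (hall : RelAllegorical r)
    {A B X : C} (R : MySpan C A B) (S : MySpan C B X) (T : MySpan C A X) :
    r (((R.comp S).meet T).meet ((R.meet (T.comp S.symm)).comp S))
      ((R.comp S).meet T) := by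
  have hM := hall.meet_modular hequiv hiso hinv hcomp R S T
  set M := (R.comp S).meet T
  set Q := (R.meet (T.comp S.symm)).comp S
  have idem {A B : C} (U : MySpan C A B) := hall.meet_self hequiv hiso hinv hcomp U
  have hMT : r (M.meet T) M := (hequiv _ _).trans (hiso.meet_assoc _ _ _)
    (hmeet.meet_congr_right hequiv hiso hcomp _ (idem T))
  have hMTQ : r ((M.meet T).meet Q) (M.meet Q) := hmeet.meet_congr_left hcomp Q hMT
  have hMQT : r ((M.meet T).meet Q) (M.meet (Q.meet T)) :=
    (hequiv _ _).trans (hiso.meet_assoc _ _ _)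
      (hmeet.meet_congr_right hequiv hiso hcomp M (hiso.meet_comm T Q))
  have hMM : r (M.meet M) (M.meet (Q.meet T)) := hmeet.meet_congr_right hequiv hiso hcomp M hM
  exact (hequiv _ _).trans ((hequiv _ _).symm hMTQ) ((hequiv _ _).trans hMQT
    ((hequiv _ _).trans ((hequiv _ _).symm hMM) (idem M)))
end
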